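/- Let R be a commutative ring, N ≥ 1, and let a_0,…,a_N and c_0,…,c_N be elements of R with c_0 = 0 and a_N = 0. Let 𝒢 be the (N+1)×(N+1) tridiagonal matrix over R with diagonal entries 𝒢_{n,n} = a_n + c_n, superdiagonal entries 𝒢_{n,n+1} = a_n, and subdiagonal entries 𝒢_{n,n−1} = c_n, and let 𝒢′ be the N×N tridiagonal matrix with diagonal entries 𝒢′_{m,m} = a_m + c_{m+1} (0 ≤ m ≤ N−1), superdiagonal entries 𝒢′_{m,m+1} = a_{m+1}, and subdiagonal entries 𝒢′_{m,m−1} = c_m. Then for every λ ∈ R, det(λ·I_{N+1} + 𝒢) = λ · det(λ·I_N + 𝒢′). In particular, the alternating column vector (1,−1,1,…,(−1)^N)^T lies in the kernel of 𝒢. -/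

import Mathlib

/-- The bidiagonal factor of size `(N + 1) × N` with `a` on the diagonal and `c` below it. -/
def bidiagonalFactor {R : Type*} [CommRing R] (N : ℕ) (a c : ℕ → R) :
    Matrix (Fin (N + 1)) (Fin N) R :=
  Matrix.of fun i k =>
    if (i : ℕ) = k then a i else if (i : ℕ) = (k : ℕ) + 1 then c i else 0

/-- The matrix of size `N × (N + 1)` sending `x` to the vector of sums `x m + x (m + 1)`. -/
def adjacentSum (R : Type*) [CommRing R] (N : ℕ) : Matrix (Fin N) (Fin (N + 1)) R :=
  Matrix.of fun k j =>
    (if j = k.castSucc then 1 else 0) + (if j = k.succ then 1 else 0)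

theorem adjacentSum_mulVec {R : Type*} [CommRing R] (N : ℕ) (x : Fin (N + 1) → R) (k : Fin N) :
    (adjacentSum R N).mulVec x k = x k.castSucc + x k.succ := by
  simp [adjacentSum, Matrix.mulVec, dotProduct, add_mul, Finset.sum_add_distrib]

theorem adjacentSum_mul_bidiagonalFactor {R : Type*} [CommRing R] (N : ℕ) (a c : ℕ → R) :
    adjacentSum R N * bidiagonalFactor N a c =
      Matrix.of (fun m k : Fin N =>
        if (k : ℕ) = (m : ℕ) + 1 then a ((m : ℕ) + 1)
        else if (m : ℕ) = (k : ℕ) + 1 then c m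
        else if m = k then a m + c ((m : ℕ) + 1)
        else 0) := by
  ext m k
  refine (adjacentSum_mulVec N (fun i => bidiagonalFactor N a c i k) m).trans ?_
  simp only [bidiagonalFactor, Matrix.of_apply, Fin.val_castSucc, Fin.val_succ, Fin.ext_iff]
  grind

theorem bidiagonalFactor_mulVec {R : Type*} [CommRing R] (N : ℕ) (a c : ℕ → R)
    (hc0 : c 0 = 0) (haN : a N = 0) (y : ℕ → R) (i : Fin (N + 1)) :
    (bidiagonalFactor N a c).mulVec (fun k => y k) i = a i * y i + c i * y ((i : ℕ) - 1) := by
  have hsplit : ∀ k : ℕ,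
      (if (i : ℕ) = k then a i else if (i : ℕ) = k + 1 then c i else 0) * y k =
        (if (i : ℕ) = k then a i * y k else 0) +
          (if (i : ℕ) = k + 1 then c i * y k else 0) := by
    intro k
    grind
  simp only [bidiagonalFactor, Matrix.mulVec, dotProduct, Matrix.of_apply, hsplit]
  rw [Fin.sum_univ_eq_sum_range (fun k =>
    (if (i : ℕ) = k then a i * y k else 0) + (if (i : ℕ) = k + 1 then c i * y k else 0)) N,
    Finset.sum_add_distrib, Finset.sum_ite_eq]
  congr 1
  · have := i.isLt
    grind
  · rcases i with ⟨_ | i, hi⟩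
    · simp [hc0]
    · have : i < N := by omega
      simp [Finset.sum_ite_eq, this]

theorem bidiagonalFactor_mul_adjacentSum {R : Type*} [CommRing R] (N : ℕ) (a c : ℕ → R)
    (hc0 : c 0 = 0) (haN : a N = 0) :
    bidiagonalFactor N a c * adjacentSum R N =
      Matrix.of (fun i j : Fin (N + 1) =>
        if (j : ℕ) = (i : ℕ) + 1 then a i
        else if (i : ℕ) = (j : ℕ) + 1 then c i
        else if i = j then a i + c i
        else 0) := by
  ext i j
  have h := bidiagonalFactor_mulVec N a c hc0 haN
    (fun k => (if (j : ℕ) = k then 1 else 0) + (if (j : ℕ) = k + 1 then 1 else 0)) i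
  have hQ : (fun k : Fin N => adjacentSum R N k j) =
      fun k : Fin N => (if (j : ℕ) = k then 1 else 0) + (if (j : ℕ) = k + 1 then 1 else 0) := by
    ext k
    simp [adjacentSum, Fin.ext_iff]
  refine (congrFun (congrArg (bidiagonalFactor N a c).mulVec hQ) i).trans (h.trans ?_)
  simp only [Matrix.of_apply, Fin.ext_iff]
  rcases i with ⟨_ | i, hi⟩ <;> grind

theorem det_smul_one_add_mul_comm_succ {R : Type*} [CommRing R] (N : ℕ)
    (P : Matrix (Fin (N + 1)) (Fin N) R) (Q : Matrix (Fin N) (Fin (N + 1)) R) (r : R) :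
    (r • (1 : Matrix (Fin (N + 1)) (Fin (N + 1)) R) + P * Q).det =
      r * (r • (1 : Matrix (Fin N) (Fin N) R) + Q * P).det := by
  have h := congrArg (Polynomial.eval r)
    (Matrix.charpoly_mul_comm_of_le (-P) Q (by simp))
  simpa [Matrix.eval_charpoly, Matrix.smul_one_eq_diagonal] using h


theorem ansatz_block_triangularization (R : Type*) [CommRing R] (N : ℕ) (hN : 1 ≤ N)
    (a c : ℕ → R) (hc0 : c 0 = 0) (haN : a N = 0) :
    (∀ lam : R,
      (lam • (1 : Matrix (Fin (N + 1)) (Fin (N + 1)) R) +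
          Matrix.of (fun i j : Fin (N + 1) =>
            if (j : ℕ) = (i : ℕ) + 1 then a i
            else if (i : ℕ) = (j : ℕ) + 1 then c i
            else if i = j then a i + c i
            else 0)).det =
        lam *
          (lam • (1 : Matrix (Fin N) (Fin N) R) +
            Matrix.of (fun m k : Fin N =>
              if (k : ℕ) = (m : ℕ) + 1 then a ((m : ℕ) + 1)
              else if (m : ℕ) = (k : ℕ) + 1 then c m
              else if m = k then a m + c ((m : ℕ) + 1)
              else 0)).det) ∧
    Matrix.mulVec
      (Matrix.of (fun i j : Fin (N + 1) =>
        if (j : ℕ) = (i : ℕ) + 1 then a i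
        else if (i : ℕ) = (j : ℕ) + 1 then c i
        else if i = j then a i + c i
        else 0))
      (fun i => (-1 : R) ^ (i : ℕ)) = 0 := by
  rw [← bidiagonalFactor_mul_adjacentSum N a c hc0 haN, ← adjacentSum_mul_bidiagonalFactor N a c]
  refine ⟨det_smul_one_add_mul_comm_succ N _ _, ?_⟩
  have h : (adjacentSum R N).mulVec (fun i => (-1 : R) ^ (i : ℕ)) = 0 := by
    ext k
    simp [adjacentSum_mulVec, pow_succ]
  rw [← Matrix.mulVec_mulVec, h, Matrix.mulVec_zero]
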